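/- Let X be a complex m×n matrix and suppose X = T C G where T is a positive semidefinite m×m matrix, C is a complex m×n matrix and G is a positive semidefinite n×n matrix. Then ‖X‖_T ≤ ‖T‖₂ · ‖C‖∞ · (max diagonal entry of G²)^{1/2}. -/

import Mathlib

open Matrix
open scoped ComplexOrder

noncomputable section

namespace MatFact

/-- ℓ² norm of a complex vector. -/
def vnorm {n : ℕ} (v : Fin n → ℂ) : ℝ := Real.sqrt (∑ j, ‖v j‖ ^ 2)

/-- Operator norm of a matrix as a map ℓ²(Fin n) → ℓ²(Fin m). -/
def opNorm {m n : ℕ} (X : Matrix (Fin m) (Fin n) ℂ) : ℝ :=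
  sSup {c : ℝ | ∃ v : Fin n → ℂ, vnorm v ≤ 1 ∧ c = vnorm (X.mulVec v)}

/-- Column norm: the maximal ℓ² norm of a column. -/
def colNorm {m n : ℕ} (X : Matrix (Fin m) (Fin n) ℂ) : ℝ :=
  ⨆ j : Fin n, vnorm (fun i => X i j)

/-- Hilbert–Schmidt (Frobenius) norm. -/
def frobNorm {m n : ℕ} (X : Matrix (Fin m) (Fin n) ℂ) : ℝ :=
  Real.sqrt (∑ i, ∑ j, ‖X i j‖ ^ 2)

/-- Schur norm: operator norm of Schur (entrywise) multiplication by `X`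
on matrices with the operator norm. -/
def schurNorm {m n : ℕ} (X : Matrix (Fin m) (Fin n) ℂ) : ℝ :=
  sSup {c : ℝ | ∃ A : Matrix (Fin m) (Fin n) ℂ, opNorm A ≤ 1 ∧
    c = opNorm (Matrix.hadamard X A)}

/-- The T-norm (bilinear Schur norm). -/
def Tnorm {m n : ℕ} (X : Matrix (Fin m) (Fin n) ℂ) : ℝ :=
  sSup {c : ℝ | ∃ (a : Fin m → ℂ) (B : Matrix (Fin m) (Fin n) ℂ),
    (∀ i, ‖a i‖ ≤ 1) ∧ opNorm B ≤ 1 ∧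
    c = vnorm (fun j => ∑ i, a i * X i j * B i j)}

/-- The F-norm: operator norm of `X` from `ℂⁿ` with the sup norm to `ℂᵐ`
with the ℓ² norm. -/
def Fnorm {m n : ℕ} (X : Matrix (Fin m) (Fin n) ℂ) : ℝ :=
  sSup {c : ℝ | ∃ v : Fin n → ℂ, (∀ j, ‖v j‖ ≤ 1) ∧ c = vnorm (X.mulVec v)}

/-- The bilinear form norm. -/
def Bnorm {m n : ℕ} (Y : Matrix (Fin m) (Fin n) ℂ) : ℝ :=
  sSup {c : ℝ | ∃ (a : Fin m → ℂ) (b : Fin n → ℂ), (∀ i, ‖a i‖ ≤ 1) ∧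
    (∀ j, ‖b j‖ ≤ 1) ∧ c = ‖∑ i, ∑ j, Y i j * a i * b j‖}

/-- The completely bounded F-norm. -/
def cbF {m n : ℕ} (X : Matrix (Fin m) (Fin n) ℂ) : ℝ :=
  sInf {c : ℝ | ∃ (A : Matrix (Fin m) (Fin n) ℂ) (ξ : Fin n → ℂ),
    X = A * Matrix.diagonal ξ ∧ c = opNorm A * vnorm ξ}

/-- The completely bounded bilinear form norm. -/
def cbB {m n : ℕ} (X : Matrix (Fin m) (Fin n) ℂ) : ℝ :=
  sInf {c : ℝ | ∃ (η : Fin m → ℂ) (B : Matrix (Fin m) (Fin n) ℂ) (ξ : Fin n → ℂ),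
    X = Matrix.diagonal η * B * Matrix.diagonal ξ ∧
    c = vnorm η * opNorm B * vnorm ξ}

/-- The range (column space) of a matrix, as a submodule of `ℂᵐ`. -/
def ran {m n : ℕ} (X : Matrix (Fin m) (Fin n) ℂ) : Submodule ℂ (Fin m → ℂ) :=
  LinearMap.range X.mulVecLin

/-- `P` is the orthogonal projection onto the subspace `E`, i.e. `P` is a
Hermitian idempotent with range `E`. -/
def IsOrthProjOnto {n : ℕ} (P : Matrix (Fin n) (Fin n) ℂ)
    (E : Submodule ℂ (Fin n → ℂ)) : Prop :=
  P.IsHermitian ∧ P * P = P ∧ ran P = E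

/-- `W` is a partial isometry with support `E` and range `F`. -/
def IsPartialIsometryFromTo {m n : ℕ} (W : Matrix (Fin m) (Fin n) ℂ)
    (E : Submodule ℂ (Fin n → ℂ)) (F : Submodule ℂ (Fin m → ℂ)) : Prop :=
  IsOrthProjOnto (Wᴴ * W) E ∧ IsOrthProjOnto (W * Wᴴ) F

/-- A cb operator factorization of `X`. -/
def IsCbOpFact {m n : ℕ} (X A : Matrix (Fin m) (Fin n) ℂ) (ξ : Fin n → ℂ) : Prop :=
  (∀ j, 0 ≤ ξ j) ∧ vnorm ξ = 1 ∧ opNorm A = cbF X ∧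
  (∀ j, ξ j = 0 → ∀ i, A i j = 0) ∧ X = A * Matrix.diagonal ξ

/-- A cb bilinear form factorization of `X`. -/
def IsCbBilFact {m n : ℕ} (X : Matrix (Fin m) (Fin n) ℂ) (η : Fin m → ℂ)
    (B : Matrix (Fin m) (Fin n) ℂ) (ξ : Fin n → ℂ) : Prop :=
  (∀ i, 0 ≤ η i) ∧ (∀ j, 0 ≤ ξ j) ∧ vnorm η = 1 ∧ vnorm ξ = 1 ∧
  opNorm B = cbB X ∧ (∀ j, ξ j = 0 → ∀ i, B i j = 0) ∧
  (∀ i, η i = 0 → ∀ j, B i j = 0) ∧ X = Matrix.diagonal η * B * Matrix.diagonal ξ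

/-- A Schur factorization of `X`. -/
def IsSchurFact {m n : ℕ} (X : Matrix (Fin m) (Fin n) ℂ)
    (F : Matrix (Fin m) (Fin m) ℂ) (W : Matrix (Fin m) (Fin n) ℂ)
    (G : Matrix (Fin n) (Fin n) ℂ) : Prop :=
  F.PosSemidef ∧ (∀ i, (F * F) i i ≤ 1) ∧ G.PosSemidef ∧ (∀ j, (G * G) j j ≤ 1) ∧
  IsPartialIsometryFromTo W (ran G) (ran F) ∧
  X = (schurNorm X : ℂ) • (F * W * G)

/-- A bilinear Schur factorization of `X`. -/
def IsBilinSchurFact {m n : ℕ} (X : Matrix (Fin m) (Fin n) ℂ)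
    (T : Matrix (Fin m) (Fin m) ℂ) (W : Matrix (Fin m) (Fin n) ℂ)
    (G : Matrix (Fin n) (Fin n) ℂ) : Prop :=
  T.PosSemidef ∧ frobNorm T = Tnorm X ∧ G.PosSemidef ∧ (∀ j, (G * G) j j ≤ 1) ∧
  IsPartialIsometryFromTo W (ran G) (ran T) ∧ X = T * W * G

/-- Maximal diagonal entry (real part) of a square matrix. -/
def maxDiag {n : ℕ} (P : Matrix (Fin n) (Fin n) ℂ) : ℝ := ⨆ i, (P i i).re

end MatFact

namespace MatFact


theorem vnorm_nonneg {n : ℕ} (v : Fin n → ℂ) : 0 ≤ vnorm v := Real.sqrt_nonneg _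

theorem vnorm_sq {n : ℕ} (v : Fin n → ℂ) : vnorm v ^ 2 = ∑ j, ‖v j‖ ^ 2 :=
  Real.sq_sqrt (by positivity)

theorem frobNorm_sq {m n : ℕ} (X : Matrix (Fin m) (Fin n) ℂ) :
    frobNorm X ^ 2 = ∑ i, ∑ j, ‖X i j‖ ^ 2 :=
  Real.sq_sqrt (by positivity)

theorem frobNorm_sq_eq_sum_col {m n : ℕ} (X : Matrix (Fin m) (Fin n) ℂ) :
    frobNorm X ^ 2 = ∑ j, vnorm (X.col j) ^ 2 := by
  simp only [frobNorm_sq, vnorm_sq, Matrix.col_apply]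
  exact Finset.sum_comm

theorem frobNorm_sq_eq_sum_row {m n : ℕ} (X : Matrix (Fin m) (Fin n) ℂ) :
    frobNorm X ^ 2 = ∑ i, vnorm (X.row i) ^ 2 := by
  simp only [frobNorm_sq, vnorm_sq, Matrix.row_apply]

theorem vnorm_star {n : ℕ} (v : Fin n → ℂ) : vnorm (star v) = vnorm v := by
  simp [vnorm]

theorem vnorm_smul {n : ℕ} (c : ℂ) (v : Fin n → ℂ) : vnorm (c • v) = ‖c‖ * vnorm v := by
  simp [vnorm, mul_pow, ← Finset.mul_sum]

theorem eq_zero_of_vnorm_eq_zero {n : ℕ} {v : Fin n → ℂ} (h : vnorm v = 0) : v = 0 := by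
  have h2 := vnorm_sq v
  rw [h, zero_pow two_ne_zero, eq_comm, Finset.sum_eq_zero_iff_of_nonneg (by simp)] at h2
  ext j
  simpa using h2 j (Finset.mem_univ j)

/-- The Cauchy–Schwarz inequality. -/
theorem norm_dotProduct_le {n : ℕ} (u v : Fin n → ℂ) : ‖u ⬝ᵥ v‖ ≤ vnorm u * vnorm v :=
  calc ‖u ⬝ᵥ v‖ ≤ ∑ i, ‖u i‖ * ‖v i‖ :=
        (norm_sum_le _ _).trans_eq (by simp)
    _ ≤ vnorm u * vnorm v := Real.sum_mul_le_sqrt_mul_sqrt _ _ _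

theorem vnorm_mulVec_le_frobNorm_mul {m n : ℕ} (X : Matrix (Fin m) (Fin n) ℂ)
    (v : Fin n → ℂ) : vnorm (X *ᵥ v) ≤ frobNorm X * vnorm v := by
  refine le_of_pow_le_pow_left₀ two_ne_zero (mul_nonneg (Real.sqrt_nonneg _) (vnorm_nonneg v)) ?_
  rw [mul_pow, vnorm_sq, frobNorm_sq_eq_sum_row, Finset.sum_mul]
  gcongr with i
  rw [← mul_pow]
  gcongr
  exact norm_dotProduct_le _ _

theorem bddAbove_opNorm {m n : ℕ} (X : Matrix (Fin m) (Fin n) ℂ) :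
    BddAbove {c : ℝ | ∃ v : Fin n → ℂ, vnorm v ≤ 1 ∧ c = vnorm (X.mulVec v)} := by
  refine ⟨frobNorm X, ?_⟩
  rintro _ ⟨v, hv, rfl⟩
  exact (vnorm_mulVec_le_frobNorm_mul X v).trans
    (mul_le_of_le_one_right (Real.sqrt_nonneg _) hv)

theorem opNorm_nonneg {m n : ℕ} (X : Matrix (Fin m) (Fin n) ℂ) : 0 ≤ opNorm X := by
  apply Real.sSup_nonneg
  rintro _ ⟨v, -, rfl⟩
  exact vnorm_nonneg _

theorem vnorm_mulVec_le {m n : ℕ} (X : Matrix (Fin m) (Fin n) ℂ) (v : Fin n → ℂ) :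
    vnorm (X *ᵥ v) ≤ opNorm X * vnorm v := by
  rcases (vnorm_nonneg v).eq_or_lt with h | h
  · rw [eq_zero_of_vnorm_eq_zero h.symm]
    simp [vnorm]
  have hc : ‖((vnorm v : ℂ))⁻¹‖ = (vnorm v)⁻¹ := by simp [abs_of_pos h]
  have hle : vnorm (X *ᵥ ((vnorm v : ℂ)⁻¹ • v)) ≤ opNorm X :=
    le_csSup (bddAbove_opNorm X) ⟨_, by rw [vnorm_smul, hc, inv_mul_cancel₀ h.ne'], rfl⟩
  rwa [Matrix.mulVec_smul, vnorm_smul, hc, inv_mul_le_iff₀ h, mul_comm] at hle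

theorem vnorm_vecMul_le {m n : ℕ} (X : Matrix (Fin m) (Fin n) ℂ) (v : Fin m → ℂ) :
    vnorm (v ᵥ* X) ≤ opNorm X * vnorm v := by
  set w := v ᵥ* X with hw
  rcases (vnorm_nonneg w).eq_or_lt with h | h
  · rw [← h]
    exact mul_nonneg (opNorm_nonneg X) (vnorm_nonneg v)
  have hsq : vnorm w ^ 2 = ‖v ⬝ᵥ X *ᵥ star w‖ := by
    have : w ⬝ᵥ star w = ((vnorm w ^ 2 : ℝ) : ℂ) := by
      simp [vnorm_sq, dotProduct, Complex.mul_conj']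
    rw [Matrix.dotProduct_mulVec, ← hw, this, Complex.norm_real, Real.norm_of_nonneg (sq_nonneg _)]
  have hle : vnorm w ^ 2 ≤ vnorm v * (opNorm X * vnorm w) := by
    rw [hsq, ← vnorm_star w]
    exact (norm_dotProduct_le _ _).trans
      (mul_le_mul_of_nonneg_left (vnorm_mulVec_le _ _) (vnorm_nonneg v))
  nlinarith

theorem frobNorm_mul_le {l m n : ℕ} (S : Matrix (Fin l) (Fin m) ℂ)
    (B : Matrix (Fin m) (Fin n) ℂ) : frobNorm (S * B) ≤ frobNorm S * opNorm B := by
  refine le_of_pow_le_pow_left₀ two_ne_zero (mul_nonneg (Real.sqrt_nonneg _) (opNorm_nonneg B)) ?_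
  rw [mul_pow, frobNorm_sq_eq_sum_row, frobNorm_sq_eq_sum_row, Finset.sum_mul]
  gcongr with i
  rw [← mul_pow, mul_comm]
  gcongr
  · exact vnorm_nonneg _
  · exact vnorm_vecMul_le B (S.row i)

theorem vnorm_col_sq_le_maxDiag {n : ℕ} {G : Matrix (Fin n) (Fin n) ℂ} (hG : G.IsHermitian)
    (j : Fin n) : vnorm (G.col j) ^ 2 ≤ maxDiag (G * G) := by
  have h : vnorm (G.col j) ^ 2 = ((G * G) j j).re := by
    rw [vnorm_sq, Matrix.mul_apply, Complex.re_sum]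
    refine Finset.sum_congr rfl fun k _ => ?_
    rw [← hG.apply j k, Matrix.col_apply, Complex.star_def, Complex.conj_mul', ← Complex.ofReal_pow,
      Complex.ofReal_re]
  rw [h]
  exact le_ciSup (f := fun i => ((G * G) i i).re) (Set.finite_range _).bddAbove j

theorem frobNorm_transpose_mul_diagonal_le {m : ℕ} (T : Matrix (Fin m) (Fin m) ℂ)
    {a : Fin m → ℂ} (ha : ∀ i, ‖a i‖ ≤ 1) :
    frobNorm (Tᵀ * Matrix.diagonal a) ≤ frobNorm T := by
  unfold frobNorm
  rw [Finset.sum_comm]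
  gcongr with i _ k
  simpa using mul_le_of_le_one_right (norm_nonneg (T i k)) (ha i)

theorem stmt10 {m n : ℕ} (X C : Matrix (Fin m) (Fin n) ℂ)
    (T : Matrix (Fin m) (Fin m) ℂ) (G : Matrix (Fin n) (Fin n) ℂ)
    (hT : T.PosSemidef) (hG : G.PosSemidef) (hX : X = T * C * G) :
    Tnorm X ≤ frobNorm T * opNorm C * Real.sqrt (maxDiag (G * G)) := by
  have hK : 0 ≤ frobNorm T * opNorm C * Real.sqrt (maxDiag (G * G)) :=
    mul_nonneg (mul_nonneg (Real.sqrt_nonneg _) (opNorm_nonneg C)) (Real.sqrt_nonneg _)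
  refine Real.sSup_le ?_ hK
  rintro _ ⟨a, B, ha, hB, rfl⟩
  set R := Tᵀ * Matrix.diagonal a * B with hR
  have hentry (j : Fin n) : ∑ i, a i * X i j * B i j = (C *ᵥ G.col j) ⬝ᵥ R.col j := by
    have hcol : R.col j = Tᵀ *ᵥ fun i => a i * B i j := by
      ext k
      simp [hR, Matrix.mul_assoc, Matrix.mul_apply, Matrix.mulVec, dotProduct,
        Matrix.diagonal_apply]
    have hXcol (i : Fin m) : X i j = (T *ᵥ (C *ᵥ G.col j)) i := by
      rw [hX, Matrix.mulVec_mulVec]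
      rfl
    rw [hcol, Matrix.dotProduct_mulVec, Matrix.vecMul_transpose]
    refine Finset.sum_congr rfl fun i _ => ?_
    rw [hXcol]
    ring
  have hRT : frobNorm R ≤ frobNorm T :=
    calc frobNorm R ≤ frobNorm (Tᵀ * Matrix.diagonal a) * opNorm B := frobNorm_mul_le _ _
      _ ≤ frobNorm (Tᵀ * Matrix.diagonal a) := mul_le_of_le_one_right (Real.sqrt_nonneg _) hB
      _ ≤ frobNorm T := frobNorm_transpose_mul_diagonal_le T ha
  have hCG (j : Fin n) :
      vnorm (C *ᵥ G.col j) ≤ opNorm C * Real.sqrt (maxDiag (G * G)) :=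
    (vnorm_mulVec_le _ _).trans (mul_le_mul_of_nonneg_left
      (Real.le_sqrt_of_sq_le (vnorm_col_sq_le_maxDiag hG.isHermitian j)) (opNorm_nonneg C))
  have hle : vnorm (fun j => ∑ i, a i * X i j * B i j) ≤
      opNorm C * Real.sqrt (maxDiag (G * G)) * frobNorm R := by
    have hc : 0 ≤ opNorm C * Real.sqrt (maxDiag (G * G)) :=
      mul_nonneg (opNorm_nonneg C) (Real.sqrt_nonneg _)
    refine le_of_pow_le_pow_left₀ two_ne_zero (mul_nonneg hc (Real.sqrt_nonneg _)) ?_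
    rw [mul_pow, vnorm_sq, frobNorm_sq_eq_sum_col, Finset.mul_sum]
    gcongr with j
    rw [← mul_pow, hentry]
    gcongr
    exact (norm_dotProduct_le _ _).trans
      (mul_le_mul_of_nonneg_right (hCG j) (vnorm_nonneg _))
  calc _ ≤ opNorm C * Real.sqrt (maxDiag (G * G)) * frobNorm R := hle
    _ ≤ opNorm C * Real.sqrt (maxDiag (G * G)) * frobNorm T :=
        mul_le_mul_of_nonneg_left hRT (mul_nonneg (opNorm_nonneg C) (Real.sqrt_nonneg _))
    _ = _ := by ring

end MatFact
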